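/- For a system of four four-functional elements (n = m = k = 4), where a state is a 4×4 Boolean matrix and operability means existence of a permutation σ ∈ S₄ with all entries (i, σ(i)) true, the total number of states is 2^16 = 65536 and the number of operable states is 37823. -/

import Mathlib

abbrev QRow := Bool × Bool × Bool × Bool
abbrev QMask := Bool × Bool × Bool × Bool × Bool × Bool

/-- which pairs of columns (01,02,03,12,13,23) two rows can be matched to -/
def qmask (p : QRow × QRow) : QMask :=
  match p with
  | ((a, b, c, d), (e, f, g, h)) =>
    (a && f || b && e, a && g || c && e, a && h || d && e,
     b && g || c && f, b && h || d && f, c && h || d && g)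

def qdot (u v : QMask) : Bool :=
  match u, v with
  | (a, b, c, d, e, f), (a', b', c', d', e', f') =>
    a && f' || b && e' || c && d' || d && c' || e && b' || f && a'

def qrow (s : Fin 4 × Fin 4 → Bool) (i : Fin 4) : QRow := (s (i, 0), s (i, 1), s (i, 2), s (i, 3))

def qget (r : QRow) (j : Fin 4) : Bool := ![r.1, r.2.1, r.2.2.1, r.2.2.2] j

def qequiv : (Fin 4 × Fin 4 → Bool) ≃ (QRow × QRow) × (QRow × QRow) where
  toFun s := ((qrow s 0, qrow s 1), (qrow s 2, qrow s 3))
  invFun p := fun x => qget (![p.1.1, p.1.2, p.2.1, p.2.2] x.1) x.2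
  left_inv s := by
    funext ⟨i, j⟩
    fin_cases i <;> fin_cases j <;> rfl
  right_inv p := rfl

theorem qoper_of (s : Fin 4 × Fin 4 → Bool) (f : Fin 4 → Fin 4) (hf : Function.Injective f)
    (h0 : s (0, f 0) = true) (h1 : s (1, f 1) = true) (h2 : s (2, f 2) = true)
    (h3 : s (3, f 3) = true) :
    ∃ σ : Equiv.Perm (Fin 4), ∀ i, s (i, σ i) = true := by
  refine ⟨Equiv.ofBijective f (Finite.injective_iff_bijective.mp hf), fun i => ?_⟩
  fin_cases i <;> assumption

theorem qoper_iff (s : Fin 4 × Fin 4 → Bool) :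
    (∃ σ : Equiv.Perm (Fin 4), ∀ i, s (i, σ i) = true) ↔
      qdot (qmask (qequiv s).1) (qmask (qequiv s).2) = true := by
  constructor
  · rintro ⟨σ, h⟩
    have h0 := h 0
    have h1 := h 1
    have h2 := h 2
    have h3 := h 3
    have n01 : σ 0 ≠ σ 1 := by simp
    have n02 : σ 0 ≠ σ 2 := by simp
    have n03 : σ 0 ≠ σ 3 := by simp
    have n12 : σ 1 ≠ σ 2 := by simp
    have n13 : σ 1 ≠ σ 3 := by simp
    have n23 : σ 2 ≠ σ 3 := by simp
    clear h
    generalize σ 0 = a at *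
    generalize σ 1 = b at *
    generalize σ 2 = c at *
    generalize σ 3 = d at *
    fin_cases a <;> fin_cases b <;> first | exact absurd rfl n01 | skip
    all_goals fin_cases c <;> first | exact absurd rfl n02 | exact absurd rfl n12 | skip
    all_goals fin_cases d <;>
      first | exact absurd rfl n03 | exact absurd rfl n13 | exact absurd rfl n23 | skip
    all_goals
      simp only [Fin.zero_eta, Fin.mk_one, Fin.reduceFinMk] at h0 h1 h2 h3
      simp [qdot, qmask, qequiv, qrow, h0, h1, h2, h3]
  · intro h
    simp only [qdot, qmask, qequiv, qrow, Equiv.coe_fn_mk, Bool.or_eq_true, Bool.and_eq_true] at h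
    rcases h with ((((⟨h | h, h' | h'⟩ | ⟨h | h, h' | h'⟩) | ⟨h | h, h' | h'⟩) |
      ⟨h | h, h' | h'⟩) | ⟨h | h, h' | h'⟩) | ⟨h | h, h' | h'⟩
    · exact qoper_of s ![0, 1, 2, 3] (by decide) h.1 h.2 h'.1 h'.2
    · exact qoper_of s ![0, 1, 3, 2] (by decide) h.1 h.2 h'.1 h'.2
    · exact qoper_of s ![1, 0, 2, 3] (by decide) h.1 h.2 h'.1 h'.2
    · exact qoper_of s ![1, 0, 3, 2] (by decide) h.1 h.2 h'.1 h'.2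
    · exact qoper_of s ![0, 2, 1, 3] (by decide) h.1 h.2 h'.1 h'.2
    · exact qoper_of s ![0, 2, 3, 1] (by decide) h.1 h.2 h'.1 h'.2
    · exact qoper_of s ![2, 0, 1, 3] (by decide) h.1 h.2 h'.1 h'.2
    · exact qoper_of s ![2, 0, 3, 1] (by decide) h.1 h.2 h'.1 h'.2
    · exact qoper_of s ![0, 3, 1, 2] (by decide) h.1 h.2 h'.1 h'.2
    · exact qoper_of s ![0, 3, 2, 1] (by decide) h.1 h.2 h'.1 h'.2
    · exact qoper_of s ![3, 0, 1, 2] (by decide) h.1 h.2 h'.1 h'.2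
    · exact qoper_of s ![3, 0, 2, 1] (by decide) h.1 h.2 h'.1 h'.2
    · exact qoper_of s ![1, 2, 0, 3] (by decide) h.1 h.2 h'.1 h'.2
    · exact qoper_of s ![1, 2, 3, 0] (by decide) h.1 h.2 h'.1 h'.2
    · exact qoper_of s ![2, 1, 0, 3] (by decide) h.1 h.2 h'.1 h'.2
    · exact qoper_of s ![2, 1, 3, 0] (by decide) h.1 h.2 h'.1 h'.2
    · exact qoper_of s ![1, 3, 0, 2] (by decide) h.1 h.2 h'.1 h'.2
    · exact qoper_of s ![1, 3, 2, 0] (by decide) h.1 h.2 h'.1 h'.2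
    · exact qoper_of s ![3, 1, 0, 2] (by decide) h.1 h.2 h'.1 h'.2
    · exact qoper_of s ![3, 1, 2, 0] (by decide) h.1 h.2 h'.1 h'.2
    · exact qoper_of s ![2, 3, 0, 1] (by decide) h.1 h.2 h'.1 h'.2
    · exact qoper_of s ![2, 3, 1, 0] (by decide) h.1 h.2 h'.1 h'.2
    · exact qoper_of s ![3, 2, 0, 1] (by decide) h.1 h.2 h'.1 h'.2
    · exact qoper_of s ![3, 2, 1, 0] (by decide) h.1 h.2 h'.1 h'.2

/-- sum over a Boolean -/
def qs (g : Bool → ℕ) : ℕ := Nat.add (g true) (g false)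

def qsumRow (g : QRow → ℕ) : ℕ := qs fun a => qs fun b => qs fun c => qs fun d => g (a, b, c, d)

def qsumMask (g : QMask → ℕ) : ℕ :=
  qs fun a => qs fun b => qs fun c => qs fun d => qs fun e => qs fun f => g (a, b, c, d, e, f)

theorem qsumRow_eq (g : QRow → ℕ) : ∑ r, g r = qsumRow g := by
  simp only [Fintype.sum_prod_type, Fintype.sum_bool, qsumRow, qs, Nat.add_eq]

theorem qsumMask_eq (g : QMask → ℕ) : ∑ r, g r = qsumMask g := by
  simp only [Fintype.sum_prod_type, Fintype.sum_bool, qsumMask, qs, Nat.add_eq]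

def qeqb (u v : QMask) : Bool :=
  match u, v with
  | (a, b, c, d, e, f), (a', b', c', d', e', f') =>
    (a == a') && (b == b') && (c == c') && (d == d') && (e == e') && (f == f')

theorem qeqb_iff (u v : QMask) : qeqb u v = true ↔ u = v := by
  obtain ⟨a, b, c, d, e, f⟩ := u
  obtain ⟨a', b', c', d', e', f'⟩ := v
  simp [qeqb, and_assoc]

/-- number of row pairs with a given mask -/
def qcnt (u : QMask) : ℕ :=
  qsumRow fun r => qsumRow fun r' => cond (qeqb (qmask (r, r')) u) 1 0

theorem qhist (F : QMask → ℕ) : ∑ p : QRow × QRow, F (qmask p) = ∑ u, qcnt u * F u := by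
  have h : ∀ u, qcnt u = ∑ p : QRow × QRow, if qmask p = u then 1 else 0 := by
    intro u
    rw [Fintype.sum_prod_type]
    simp only [qcnt, ← qsumRow_eq]
    refine Finset.sum_congr rfl fun r _ => Finset.sum_congr rfl fun r' _ => ?_
    rw [Bool.cond_eq_ite]
    simp only [qeqb_iff]
  simp only [h, Finset.sum_mul]
  rw [Finset.sum_comm]
  simp

/-- the values of `qcnt` -/
def qtab (u : QMask) : ℕ :=
  match u with
  | (a, b, c, d, e, f) =>
    (cond a (cond b (cond c (cond d (cond e (cond f 21 6) (cond f 6 0)) (cond e (cond f 6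
    0) (cond f 0 4))) (cond d (cond e (cond f 6 0) (cond f 0 13)) (cond e (cond f 2 0)
    (cond f 0 4)))) (cond c (cond d (cond e (cond f 6 0) (cond f 2 0)) (cond e (cond f 0
    13) (cond f 0 4))) (cond d (cond e (cond f 0 4) (cond f 0 4)) (cond e (cond f 0 4)
    (cond f 0 7))))) (cond b (cond c (cond d (cond e (cond f 6 2) 0) (cond e 0 (cond f 13
    4))) (cond d (cond e 0 (cond f 4 4)) (cond e 0 (cond f 4 7)))) (cond c (cond d 0 (cond
    e (cond f 4 4) (cond f 4 7))) (cond d (cond e (cond f 13 4) (cond f 4 7)) (cond e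
    (cond f 4 7) (cond f 7 35))))))

set_option maxRecDepth 100000 in
theorem qcnt_beq : ∀ a b c d e f,
    Nat.beq (qcnt (a, b, c, d, e, f)) (qtab (a, b, c, d, e, f)) = true := by
  decide +kernel

theorem qcnt_eq (a b c d e f) : qcnt (a, b, c, d, e, f) = qtab (a, b, c, d, e, f) :=
  Nat.eq_of_beq_eq_true (qcnt_beq a b c d e f)

def qtotal : ℕ :=
  qsumMask fun u => qtab u * qsumMask fun v => qtab v * cond (qdot u v) 1 0

set_option maxRecDepth 100000 in
theorem qtotal_beq : Nat.beq qtotal 37823 = true := by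
  decide +kernel

theorem qtotal_eq : qtotal = 37823 := Nat.eq_of_beq_eq_true qtotal_beq

theorem quad_core_operable_count :
    Fintype.card (Fin 4 × Fin 4 → Bool) = 65536 ∧
    Fintype.card {s : Fin 4 × Fin 4 → Bool //
        ∃ σ : Equiv.Perm (Fin 4), ∀ i, s (i, σ i) = true} = 37823 := by
  refine ⟨by simp, ?_⟩
  rw [← qtotal_eq]
  have ht : qtab = qcnt := by
    funext ⟨a, b, c, d, e, f⟩
    exact (qcnt_eq a b c d e f).symm
  simp only [qtotal, ← qsumMask_eq, ht]
  rw [← qhist fun u => ∑ v, qcnt v * cond (qdot u v) 1 0]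
  simp only [← qhist]
  rw [Fintype.card_subtype, Finset.card_filter]
  simp only [qoper_iff]
  rw [Equiv.sum_comp qequiv
    (fun p => if qdot (qmask p.1) (qmask p.2) = true then 1 else 0), Fintype.sum_prod_type]
  simp only [Bool.cond_eq_ite]
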